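/- Let n be a positive integer and let M_1 and M_2 be nonnegative integers. Then the sum over all integer tuples (k_1,…,k_n) with k_1+⋯+k_n = 0 and with M_2 - n·k_i + n - i ≥ 0 for all i (a finite sum) of the quantity q^{binom(n+1,2)·(k_1²+⋯+k_n²) + (1·k_1+2·k_2+⋯+n·k_n)} · ∏_{1≤i<j≤n} (1 - q^{n·k_j - n·k_i + j - i}) · ∏_{i=1}^{n} (q^{M_1+n·k_i+i};q)_{M_2-n·k_i+n} / (q;q)_{M_2-n·k_i+n-i} equals (q^{M_1+1};q)_{M_2} / (q;q)_{M_2} · ∏_{i=1}^{n} (q^{M_1+M_2+i};q)_n. -/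

import Mathlib

open Finset

/-- The q-shifted factorial (q-Pochhammer symbol) `(a;q)_k = ∏_{j=0}^{k-1} (1 - a q^j)`. -/
noncomputable def qPoch {F : Type*} [Field F] (q a : F) (k : ℕ) : F :=
  ∏ j ∈ Finset.range k, (1 - a * q ^ j)

theorem zpow_sum₀ {ι F : Type*} [Field F] {q : F} (hq0 : q ≠ 0) (s : Finset ι) (f : ι → ℤ) :
    q ^ (∑ i ∈ s, f i) = ∏ i ∈ s, q ^ f i := by
  induction s using Finset.cons_induction with
  | empty => simp
  | cons a s ha ih => rw [sum_cons, prod_cons, zpow_add₀ hq0, ih]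

/-- The Vandermonde determinant in the variables `q ^ β i`. -/
noncomputable def powVandermonde {F : Type*} [Field F] (q : F) {m : ℕ} (β : Fin m → ℤ) : F :=
  (Matrix.vandermonde fun i => q ^ β i).det

theorem powVandermonde_comp_perm {F : Type*} [Field F] (q : F) {m : ℕ} (β : Fin m → ℤ)
    (σ : Equiv.Perm (Fin m)) :
    powVandermonde q (β ∘ σ) = ((Equiv.Perm.sign σ : ℤ) : F) * powVandermonde q β :=
  Matrix.det_permute σ (Matrix.vandermonde fun i => q ^ β i)

theorem powVandermonde_eq_zero {F : Type*} [Field F] (q : F) {m : ℕ} (β : Fin m → ℤ)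
    {a b : Fin m} (hab : a ≠ b) (h : β a = β b) : powVandermonde q β = 0 :=
  Matrix.det_zero_of_row_eq hab (by ext j; simp [Matrix.vandermonde, h])

theorem powVandermonde_eq_sum {F : Type*} [Field F] (q : F) (hq0 : q ≠ 0) {m : ℕ}
    (β : Fin m → ℤ) :
    powVandermonde q β = ∑ σ : Equiv.Perm (Fin m), ((Equiv.Perm.sign σ : ℤ) : F) *
      q ^ ∑ i : Fin m, ((i : ℕ) : ℤ) * β (σ i) := by
  rw [powVandermonde, Matrix.det_apply']
  refine sum_congr rfl fun σ _ => ?_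
  congr 1
  rw [zpow_sum₀ hq0]
  refine prod_congr rfl fun i _ => ?_
  rw [Matrix.vandermonde_apply, mul_comm ((i : ℕ) : ℤ), zpow_mul, zpow_natCast]

/-- Swapping two entries that lie in the same residue class cancels all terms in which some
entry of index `i` with `i + s < m` is not minimal. -/
theorem sum_piAntidiag_alternating {F : Type*} [Field F] {m : ℕ} (s : ℕ) (hs : 0 < s) (M : ℕ)
    (G : (Fin m → ℤ) → F)
    (hswap : ∀ β a b, a ≠ b → G (β ∘ Equiv.swap a b) = -G β)
    (hzero : ∀ β a b, a ≠ b → β a = β b → G β = 0) :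
    ∑ μ ∈ piAntidiag (univ : Finset (Fin m)) M, G (fun i => (i : ℕ) + s * (μ i : ℤ)) =
      ∑ μ ∈ piAntidiag (univ : Finset (Fin m)) M with ∀ i : Fin m, (i : ℕ) + s < m → μ i = 0,
        G (fun i => (i : ℕ) + s * (μ i : ℤ)) := by
  have key (t : ℕ) :
      ∑ μ ∈ piAntidiag (univ : Finset (Fin m)) M, G (fun i => (i : ℕ) + s * (μ i : ℤ)) =
        ∑ μ ∈ piAntidiag (univ : Finset (Fin m)) M with
          ∀ i : Fin m, (i : ℕ) < t → (i : ℕ) + s < m → μ i = 0,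
          G (fun i => (i : ℕ) + s * (μ i : ℤ)) := by
    induction t with
    | zero => simp
    | succ t ih =>
      rw [ih]
      by_cases hts : t + s < m
      swap
      · refine sum_congr (filter_congr fun μ _ => forall_congr' fun i => ?_) fun _ _ => rfl
        grind
      set a : Fin m := ⟨t, by omega⟩ with ha
      set b : Fin m := ⟨t + s, hts⟩ with hb
      have hab : a ≠ b := by simp [ha, hb, Fin.ext_iff]; omega
      rw [← sum_filter_add_sum_filter_not (s := filter _ _) (p := fun μ => μ a = 0)]
      have hvanish : ∑ μ ∈ (piAntidiag (univ : Finset (Fin m)) M).filter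
          (fun μ => ∀ i : Fin m, (i : ℕ) < t → (i : ℕ) + s < m → μ i = 0) with ¬ μ a = 0,
            G (fun i => (i : ℕ) + s * (μ i : ℤ)) = 0 := by
        let g (μ : Fin m → ℕ) : Fin m → ℕ :=
          fun i => if i = a then μ b + 1 else if i = b then μ a - 1 else μ i
        have hcomp (μ : Fin m → ℕ) (hμ : μ a ≠ 0) :
            (fun i : Fin m => ((i : ℕ) : ℤ) + s * (g μ i : ℤ)) =
              (fun i : Fin m => ((i : ℕ) : ℤ) + s * (μ i : ℤ)) ∘ Equiv.swap a b := by
          funext i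
          obtain ⟨x, hx⟩ : ∃ x, μ a = x + 1 := ⟨μ a - 1, by omega⟩
          by_cases hia : i = a
          · subst hia
            simp [g, ha, hb]; ring
          · by_cases hib : i = b
            · subst hib
              simp [g, hab.symm, hx]
              simp [ha, hb]
              ring
            · simp [g, hia, hib, Equiv.swap_apply_of_ne_of_ne hia hib]
        refine sum_involution (fun μ _ => g μ) ?_ ?_ ?_ ?_
        · intro μ hμ
          simp only [mem_filter] at hμ
          rw [hcomp μ hμ.2, hswap _ _ _ hab, add_neg_cancel]
        · intro μ hμ hne heq
          simp only [mem_filter] at hμ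
          refine hne (hzero _ a b hab ?_)
          have h1 := congrFun heq a
          simp only [g, if_true] at h1
          rw [← h1]; simp [ha, hb]; ring
        · intro μ hμ
          simp only [mem_filter, mem_piAntidiag, mem_univ, implies_true, and_true] at hμ ⊢
          obtain ⟨⟨hsum, hmin⟩, hμa⟩ := hμ
          refine ⟨⟨?_, ?_⟩, by simp [g]⟩
          · rw [← hsum, ← add_sum_erase _ _ (mem_univ a), ← add_sum_erase _ μ (mem_univ a),
              ← add_sum_erase _ _ (mem_erase.2 ⟨hab.symm, mem_univ b⟩),
              ← add_sum_erase _ μ (mem_erase.2 ⟨hab.symm, mem_univ b⟩)]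
            have : ∑ x ∈ (univ.erase a).erase b, g μ x = ∑ x ∈ (univ.erase a).erase b, μ x := by
              refine sum_congr rfl fun i hi => ?_
              simp only [mem_erase] at hi
              simp [g, hi.1, hi.2.1]
            rw [this]
            simp only [if_true, hab.symm, if_false]
            omega
          · intro i hi his
            have h1 : i ≠ a := by rintro rfl; simp [ha] at hi
            have h2 : i ≠ b := by rintro rfl; simp [hb] at hi
            simp [g, h1, h2, hmin i hi his]
        · intro μ hμ
          simp only [mem_filter] at hμ
          funext i
          by_cases hia : i = a
          · subst hia
            simp [g, hab.symm]; omega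
          · by_cases hib : i = b
            · subst hib
              simp [g, hab.symm]
            · simp [g, hia, hib]
      rw [hvanish, add_zero, filter_filter]
      refine sum_congr (filter_congr fun μ _ => ⟨?_, ?_⟩) fun _ _ => rfl
      · rintro ⟨h1, h2⟩ i hi his
        by_cases hit : (i : ℕ) = t
        · rwa [show i = a from Fin.ext hit]
        · exact h1 i (by omega) his
      · exact fun h => ⟨fun i hi his => h i (by omega) his, h a (by simp [ha]) (by simpa [ha])⟩
  rw [key m]
  refine sum_congr (filter_congr fun μ _ => forall_congr' fun i => ?_) fun _ _ => rfl
  simp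

/-- The two Gaussian-weighted sums over `μ` are exchanged by expanding the determinants. -/
theorem sum_powVandermonde_exchange {F : Type*} [Field F] (q : F) (hq0 : q ≠ 0) (m s M : ℕ) :
    ∑ μ ∈ piAntidiag (univ : Finset (Fin m)) M,
        q ^ ((s : ℤ) * (∑ i, ((μ i).choose 2 : ℤ)) + ∑ i : Fin m, ((i : ℕ) : ℤ) * μ i) *
          powVandermonde q (fun i => (i : ℕ) + s * (μ i : ℤ)) =
      ∑ μ ∈ piAntidiag (univ : Finset (Fin m)) M,
        q ^ ((s : ℤ) * (∑ i, ((μ i).choose 2 : ℤ)) + s * ∑ i : Fin m, ((i : ℕ) : ℤ) * μ i) *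
          powVandermonde q (fun i => (i : ℕ) + (μ i : ℤ)) := by
  simp_rw [powVandermonde_eq_sum q hq0, mul_sum]
  rw [← sum_product', ← sum_product']
  refine sum_bij' (fun x _ => (x.1 ∘ x.2, x.2⁻¹)) (fun x _ => (x.1 ∘ x.2, x.2⁻¹)) ?_ ?_ ?_ ?_ ?_
  · rintro ⟨μ, σ⟩ h
    simp only [mem_product, mem_piAntidiag, mem_univ, implies_true, and_true] at h ⊢
    rw [← h]; exact Equiv.sum_comp σ μ
  · rintro ⟨μ, σ⟩ h
    simp only [mem_product, mem_piAntidiag, mem_univ, implies_true, and_true] at h ⊢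
    rw [← h]; exact Equiv.sum_comp σ μ
  · rintro ⟨μ, σ⟩ h
    simp [Function.comp_assoc]
  · rintro ⟨μ, σ⟩ h
    simp [Function.comp_assoc]
  · rintro ⟨μ, σ⟩ h
    simp only [Equiv.Perm.sign_inv]
    rw [mul_left_comm, mul_left_comm (q ^ _) _ (q ^ _), ← zpow_add₀ hq0, ← zpow_add₀ hq0]
    congr 2
    have h1 : ∑ i, (((μ ∘ σ) i).choose 2 : ℤ) = ∑ i, ((μ i).choose 2 : ℤ) :=
      Equiv.sum_comp σ fun i => ((μ i).choose 2 : ℤ)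
    have h2 : ∑ i : Fin m, ((i : ℕ) : ℤ) * (((σ⁻¹ i : Fin m) : ℕ) : ℤ) =
        ∑ i : Fin m, ((i : ℕ) : ℤ) * ((σ i : ℕ) : ℤ) := by
      rw [← Equiv.sum_comp σ]
      exact sum_congr rfl fun i _ => by simp [mul_comm]
    have h3 (i : Fin m) : (μ ∘ σ) (σ⁻¹ i) = μ i := by simp
    simp only [mul_add, sum_add_distrib, h2, h3, ← mul_sum, h1]
    simp only [mul_sum, Function.comp_apply]
    simp only [mul_left_comm]
    ring

theorem powVandermonde_append {F : Type*} [Field F] (q : F) {r n : ℕ}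
    (α : Fin r → ℤ) (β : Fin n → ℤ) :
    powVandermonde q (Fin.append α β) = powVandermonde q α * powVandermonde q β *
      ∏ i, ∏ j, (q ^ β i - q ^ α j) := by
  have h (m : ℕ) (γ : Fin m → ℤ) : powVandermonde q γ =
      ∏ i, ∏ j, if i < j then q ^ γ j - q ^ γ i else 1 := by
    rw [powVandermonde, Matrix.det_vandermonde]
    refine prod_congr rfl fun i _ => ?_
    rw [← prod_filter]
    exact prod_congr (by ext; simp) fun _ _ => rfl
  simp only [h, Fin.prod_univ_add, prod_mul_distrib, Fin.append_left, Fin.append_right]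
  have h1 (i : Fin r) (j : Fin n) : Fin.castAdd n i < Fin.natAdd r j := by
    simp [Fin.lt_def]; omega
  have h2 (i : Fin r) (j : Fin n) : ¬ Fin.natAdd r j < Fin.castAdd n i := by
    simp [Fin.lt_def]; omega
  have h3 (i j : Fin r) : Fin.castAdd n i < Fin.castAdd n j ↔ i < j := Iff.rfl
  have h4 (i j : Fin n) : Fin.natAdd r i < Fin.natAdd r j ↔ i < j := by simp
  simp only [h1, h2, h3, h4, if_true, if_false, prod_const_one]
  rw [prod_comm (s := (univ : Finset (Fin r))) (t := (univ : Finset (Fin n)))]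
  ring

theorem two_mul_choose_two_cast (a : ℕ) : 2 * (a.choose 2 : ℤ) = (a : ℤ) ^ 2 - a := by
  rcases a with _ | a
  · simp
  · rw [Nat.choose_two_right]
    have h2 : 2 ∣ (a + 1) * (a + 1 - 1) := by
      simpa [mul_comm] using (Nat.even_mul_succ_self a).two_dvd
    zify [h2]
    rw [Int.mul_ediv_cancel' (by exact_mod_cast h2)]
    push_cast
    ring

theorem sum_powVandermonde_minimal {F : Type*} [Field F] (q : F) (m s t M : ℕ) (hs : 0 < s) :
    ∑ μ ∈ piAntidiag (univ : Finset (Fin m)) M,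
        q ^ ((t : ℤ) * s * (∑ i, ((μ i).choose 2 : ℤ)) + t * ∑ i : Fin m, ((i : ℕ) : ℤ) * μ i) *
          powVandermonde q (fun i => (i : ℕ) + s * (μ i : ℤ)) =
      ∑ μ ∈ piAntidiag (univ : Finset (Fin m)) M with ∀ i : Fin m, (i : ℕ) + s < m → μ i = 0,
        q ^ ((t : ℤ) * s * (∑ i, ((μ i).choose 2 : ℤ)) + t * ∑ i : Fin m, ((i : ℕ) : ℤ) * μ i) *
          powVandermonde q (fun i => (i : ℕ) + s * (μ i : ℤ)) := by
  let G (β : Fin m → ℤ) : F :=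
    q ^ ((t * (∑ i, β i ^ 2 - ∑ i : Fin m, ((i : ℕ) : ℤ) ^ 2 - s ^ 2 * M)) / (2 * s)) *
      powVandermonde q β
  have hG (μ : Fin m → ℕ) (hμ : μ ∈ piAntidiag (univ : Finset (Fin m)) M) :
      q ^ ((t : ℤ) * s * (∑ i, ((μ i).choose 2 : ℤ)) + t * ∑ i : Fin m, ((i : ℕ) : ℤ) * μ i) *
          powVandermonde q (fun i => (i : ℕ) + s * (μ i : ℤ)) =
        G (fun i => (i : ℕ) + s * (μ i : ℤ)) := by
    simp only [mem_piAntidiag, mem_univ, implies_true, and_true] at hμ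
    simp only [G]
    congr 2
    symm
    apply Int.ediv_eq_of_eq_mul_right (by positivity)
    have : (t : ℤ) * (∑ i : Fin m, (((i : ℕ) : ℤ) + s * (μ i : ℤ)) ^ 2 -
        ∑ i : Fin m, ((i : ℕ) : ℤ) ^ 2 - s ^ 2 * M) =
        t * ∑ i : Fin m, (s * (s * (2 * ((μ i).choose 2 : ℤ)) + 2 * (((i : ℕ) : ℤ) * μ i))) := by
      rw [← hμ]
      push_cast
      rw [mul_sum, ← sum_sub_distrib, ← sum_sub_distrib]
      congr 1
      refine sum_congr rfl fun i _ => ?_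
      linear_combination -(s : ℤ) ^ 2 * two_mul_choose_two_cast (μ i)
    rw [this, ← mul_sum, sum_add_distrib, ← mul_sum, ← mul_sum, ← mul_sum]
    ring
  rw [sum_congr rfl hG, sum_congr rfl fun μ hμ => hG μ (mem_filter.1 hμ).1]
  refine sum_piAntidiag_alternating s hs M G ?_ ?_
  · intro β a b hab
    simp only [G, powVandermonde_comp_perm, Equiv.Perm.sign_swap hab]
    have : ∑ i, (β ∘ Equiv.swap a b) i ^ 2 = ∑ i, β i ^ 2 :=
      Equiv.sum_comp (Equiv.swap a b) fun i => β i ^ 2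
    rw [this]
    simp
  · intro β a b hab h
    simp only [G, powVandermonde_eq_zero q β hab h, mul_zero]

theorem sum_powVandermonde_split {F : Type*} [Field F] (q : F) (r n t M : ℕ) (hn : 0 < n) :
    ∑ μ ∈ piAntidiag (univ : Finset (Fin (r + n))) M,
        q ^ ((t : ℤ) * n * (∑ i, ((μ i).choose 2 : ℤ)) +
            t * ∑ i : Fin (r + n), ((i : ℕ) : ℤ) * μ i) *
          powVandermonde q (fun i => (i : ℕ) + n * (μ i : ℤ)) =
      powVandermonde q (fun j : Fin r => ((j : ℕ) : ℤ)) *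
      ∑ ν ∈ piAntidiag (univ : Finset (Fin n)) M,
        q ^ ((t : ℤ) * n * (∑ i, ((ν i).choose 2 : ℤ)) +
            t * ∑ i : Fin n, ((r : ℤ) + (i : ℕ)) * ν i) *
          (powVandermonde q (fun i => (r : ℤ) + ((i : ℕ) + n * (ν i : ℤ))) *
          ∏ i : Fin n, ∏ j ∈ range r, (q ^ ((r : ℤ) + ((i : ℕ) + n * (ν i : ℤ))) - q ^ j)) := by
  rw [sum_powVandermonde_minimal q _ n t M hn, mul_sum]
  symm
  refine sum_bij' (fun ν _ => Fin.append (fun _ => 0) ν) (fun μ _ i => μ (Fin.natAdd r i))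
    ?_ ?_ ?_ ?_ ?_
  · intro ν hν
    simp only [mem_filter, mem_piAntidiag, mem_univ, implies_true, and_true] at hν ⊢
    refine ⟨by simpa [Fin.sum_univ_add] using hν, fun i hi => ?_⟩
    have : i = Fin.castAdd n ⟨i, by omega⟩ := rfl
    rw [this, Fin.append_left]
  · intro μ hμ
    simp only [mem_filter, mem_piAntidiag, mem_univ, implies_true, and_true] at hμ ⊢
    rw [← hμ.1, Fin.sum_univ_add, sum_eq_zero fun i _ => hμ.2 (Fin.castAdd n i) (by simp), zero_add]
  · intro ν _
    funext i; simp
  · intro μ hμ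
    simp only [mem_filter] at hμ
    funext i
    refine Fin.addCases (fun i => ?_) (fun i => ?_) i
    · rw [Fin.append_left, hμ.2 _ (by simp)]
    · rw [Fin.append_right]
  · intro ν _
    have h : (fun i : Fin (r + n) => ((i : ℕ) : ℤ) + n * (Fin.append (fun _ => 0) ν i : ℕ)) =
        Fin.append (fun j : Fin r => ((j : ℕ) : ℤ))
          (fun i : Fin n => (r : ℤ) + ((i : ℕ) + n * (ν i : ℤ))) := by
      funext i
      refine Fin.addCases (fun i => ?_) (fun i => ?_) i
      · simp
      · simp [add_assoc]
    rw [h, powVandermonde_append]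
    have h2 (i : Fin n) : ∏ j : Fin r, (q ^ ((r : ℤ) + ((i : ℕ) + n * (ν i : ℤ))) -
        q ^ (((j : ℕ) : ℤ))) =
        ∏ j ∈ range r, (q ^ ((r : ℤ) + ((i : ℕ) + n * (ν i : ℤ))) - q ^ j) := by
      rw [← Fin.prod_univ_eq_prod_range (fun j : ℕ => _ - q ^ j)]
      simp
    simp only [h2]
    simp [Fin.sum_univ_add]
    ring

theorem powVandermonde_natCast_ne_zero {F : Type*} [Field F] (q : F)
    (hq : ∀ a b : ℕ, a < b → q ^ b ≠ q ^ a) (r : ℕ) :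
    powVandermonde q (fun j : Fin r => ((j : ℕ) : ℤ)) ≠ 0 := by
  rw [powVandermonde, Matrix.det_vandermonde]
  refine prod_ne_zero_iff.2 fun i _ => prod_ne_zero_iff.2 fun j hj => sub_ne_zero.2 ?_
  simpa using hq i j (by simpa using hj)

theorem powVandermonde_natCast_add {F : Type*} [Field F] (q : F) (r n : ℕ) :
    powVandermonde q (fun j : Fin (r + n) => ((j : ℕ) : ℤ)) =
      powVandermonde q (fun j : Fin r => ((j : ℕ) : ℤ)) *
        ∏ a ∈ range n, ∏ j ∈ range (r + a), (q ^ (r + a) - q ^ j) := by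
  induction n with
  | zero => simp
  | succ n ih =>
    rw [prod_range_succ, ← mul_assoc, ← ih]
    have h : (fun i : Fin (r + n + 1) => ((i : ℕ) : ℤ)) =
        Fin.append (fun j : Fin (r + n) => ((j : ℕ) : ℤ)) (fun _ : Fin 1 => ((r + n : ℕ) : ℤ)) := by
      funext i
      refine Fin.addCases (fun i => ?_) (fun i => ?_) i
      · simp
      · simp
    change powVandermonde q (fun i : Fin (r + n + 1) => ((i : ℕ) : ℤ)) = _
    rw [h, powVandermonde_append, ← Fin.prod_univ_eq_prod_range (fun j : ℕ => q ^ (r + n) - q ^ j)]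
    simp [powVandermonde]
    simp [← zpow_natCast]

/-- The Gaussian sum over `μ` localised to `n` rows, in closed form. -/
theorem sum_powVandermonde_eval {F : Type*} [Field F] (q : F) (hq0 : q ≠ 0)
    (hq : ∀ a b : ℕ, a < b → q ^ b ≠ q ^ a) (r n M : ℕ) :
    ∑ ν ∈ piAntidiag (univ : Finset (Fin (n + 1))) M,
        q ^ (((n + 1 : ℕ) : ℤ) * (∑ i, ((ν i).choose 2 : ℤ)) +
            ∑ i : Fin (n + 1), ((r : ℤ) + (i : ℕ)) * ν i) *
          (powVandermonde q (fun i => (r : ℤ) + ((i : ℕ) + (n + 1 : ℕ) * (ν i : ℤ))) *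
          ∏ i : Fin (n + 1), ∏ j ∈ range r,
            (q ^ ((r : ℤ) + ((i : ℕ) + (n + 1 : ℕ) * (ν i : ℤ))) - q ^ j)) =
      q ^ (((n + 1 : ℕ) : ℤ) * (M.choose 2 : ℤ) + (n + 1 : ℕ) * ((r + n) * M)) *
        ((∏ a ∈ range n, ∏ j ∈ range (r + a), (q ^ (r + a) - q ^ j)) *
          ∏ j ∈ range (r + n), (q ^ (r + n + M) - q ^ j)) := by
  refine mul_left_cancel₀ (powVandermonde_natCast_ne_zero q hq r) ?_
  have h1 := sum_powVandermonde_split q r (n + 1) 1 M n.succ_pos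
  have h2 := sum_powVandermonde_split q (r + n) 1 (n + 1) M one_pos
  have h3 := sum_powVandermonde_exchange q hq0 (r + (n + 1)) (n + 1) M
  simp only [Nat.cast_one, one_mul, mul_one] at h1 h2
  rw [← h1, h3]
  refine h2.trans ?_
  have h4 : piAntidiag (univ : Finset (Fin 1)) M = {fun _ => M} := by
    ext f
    simp [funext_iff, Fin.forall_fin_one]
  rw [h4, sum_singleton, powVandermonde_natCast_add]
  simp only [powVandermonde, Fin.sum_univ_one, Fin.prod_univ_one, Matrix.det_unique]
  simp [mul_assoc]
  norm_cast
  left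
  ring

theorem two_mul_sum_range_cast (n : ℕ) : 2 * ∑ i ∈ range n, (i : ℤ) = n * (n - 1) := by
  induction n with
  | zero => simp
  | succ n ih => rw [sum_range_succ, mul_add, ih]; push_cast; ring

theorem six_mul_sum_range_sq_cast (n : ℕ) :
    6 * ∑ i ∈ range n, (i : ℤ) ^ 2 = n * (n - 1) * (2 * n - 1) := by
  induction n with
  | zero => simp
  | succ n ih => rw [sum_range_succ, mul_add, ih]; push_cast; ring

/-- The reflection followed by a rotation by `M`, which sorts the numbers `M + n - i` into their
residue classes modulo `n + 1`. -/
theorem exists_perm_mod (n M : ℕ) : ∃ σ : Equiv.Perm (Fin (n + 1)),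
    (Equiv.Perm.sign σ : ℤ) = (-1) ^ (n * M + (n + 1).choose 2) ∧
      ∀ i, (σ i : ℕ) = (M + (n - i)) % (n + 1) := by
  refine ⟨finRotate (n + 1) ^ M * Fin.revPerm, ?_, ?_⟩
  · have hrev : (Equiv.Perm.sign (Fin.revPerm : Equiv.Perm (Fin (n + 1)))) =
        (-1) ^ (n + 1).choose 2 := by
      rw [Equiv.Perm.sign_eq_prod_prod_Iio]
      have h (j : Fin (n + 1)) : (∏ i ∈ Iio j, if Fin.revPerm i < Fin.revPerm j then (1 : ℤˣ)
          else -1) = (-1) ^ (j : ℕ) := by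
        rw [prod_congr rfl (g := fun _ => -1) fun i hi => ?_, prod_const, Fin.card_Iio]
        simp only [mem_Iio] at hi
        simp [hi.le]
      simp only [h]
      rw [prod_pow_eq_pow_sum, Fin.sum_univ_eq_sum_range (fun i => i), sum_range_id,
        Nat.choose_two_right]
    rw [Equiv.Perm.sign_mul, map_pow, hrev, sign_finRotate, ← pow_mul, ← pow_add]
    simp
  · intro i
    have h (M : ℕ) (j : Fin (n + 1)) :
        ((finRotate (n + 1) ^ M) j : ℕ) = (M + j) % (n + 1) := by
      induction M with
      | zero => simp [Nat.mod_eq_of_lt j.isLt]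
      | succ M ih =>
        rw [pow_succ', Equiv.Perm.mul_apply, finRotate_apply, Fin.val_add, ih, Fin.val_one',
          ← Nat.add_mod, Nat.add_right_comm]
    rw [Equiv.Perm.mul_apply, h]
    simp [Fin.val_rev]

theorem sum_div_of_perm_mod {n M : ℕ} {σ : Equiv.Perm (Fin (n + 1))}
    (hσ : ∀ i, (σ i : ℕ) = (M + (n - i)) % (n + 1)) :
    ∑ i : Fin (n + 1), (M + (n - i)) / (n + 1) = M := by
  have h1 : ∑ i : Fin (n + 1), (M + (n - i)) =
      ∑ i, (σ i : ℕ) + (n + 1) * ∑ i : Fin (n + 1), (M + (n - i)) / (n + 1) := by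
    rw [mul_sum, ← sum_add_distrib]
    exact sum_congr rfl fun i _ => by rw [hσ, Nat.mod_add_div]
  have h2 : ∑ i : Fin (n + 1), (n - (i : ℕ)) = ∑ i : Fin (n + 1), (i : ℕ) := by
    rw [← Equiv.sum_comp Fin.revPerm (fun i : Fin (n + 1) => (i : ℕ))]
    exact sum_congr rfl fun i _ => by simp [Fin.val_rev]
  rw [Equiv.sum_comp σ (fun i : Fin (n + 1) => (i : ℕ)), sum_add_distrib, h2] at h1
  simp at h1
  have : (n + 1) * ∑ i : Fin (n + 1), (M + (n - i)) / (n + 1) = (n + 1) * M := by omega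
  exact Nat.eq_of_mul_eq_mul_left n.succ_pos this

theorem sum_of_perm {n M : ℕ} {σ : Equiv.Perm (Fin (n + 1))} {μ y : Fin (n + 1) → ℕ}
    (hy : ∀ i, y i = σ i + (n + 1) * μ (σ i)) (hμ : ∑ i, μ i = M) :
    ∑ i, y i = (n + 1) * M + (n + 1).choose 2 := by
  simp only [hy]
  rw [Equiv.sum_comp σ (fun i : Fin (n + 1) => (i : ℕ) + (n + 1) * μ i), sum_add_distrib,
    ← mul_sum, hμ, Fin.sum_univ_eq_sum_range (fun i => i), sum_range_id, Nat.choose_two_right]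
  ring

theorem exponent_identity (n r M : ℕ) (σ : Equiv.Perm (Fin (n + 1))) (μ y : Fin (n + 1) → ℕ)
    (k : Fin (n + 1) → ℤ) (hy : ∀ i, y i = σ i + (n + 1) * μ (σ i))
    (hk : ∀ i : Fin (n + 1), (n + 1) * k i = M + n - (i : ℕ) - y i) (hμ : ∑ i, μ i = M) :
    (((n + 1 + 1).choose 2 : ℕ) : ℤ) * (∑ i, k i ^ 2) +
        ∑ i : Fin (n + 1), (((i : ℕ) : ℤ) + 1) * k i -
        ∑ i : Fin (n + 1), ((i : ℕ) : ℤ) * (r + y i) -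
        ∑ i, ((r * y i + (y i + 1).choose 2 + r.choose 2 : ℕ) : ℤ) +
        (((n + 1 : ℕ) : ℤ) * (M.choose 2 : ℤ) + (n + 1 : ℕ) * ((r + n) * M)) =
      (((n + 1 : ℕ) : ℤ) * (∑ i, ((μ i).choose 2 : ℤ)) +
        ∑ i : Fin (n + 1), ((r : ℤ) + (i : ℕ)) * μ i) -
      (((r + n) * M + (M + 1).choose 2 + (r + n).choose 2 : ℕ) + (r * n + (n + 1).choose 2 : ℕ) +
        ∑ a ∈ range n, ((r * a + (a + 1).choose 2 + (r + a).choose 2 : ℕ) : ℤ)) := by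
  have hy1 : ∑ i, (y i : ℤ) = (n + 1) * M + ((n + 1).choose 2 : ℕ) := by
    exact_mod_cast sum_of_perm hy hμ
  have hy2 : ∑ i, (y i : ℤ) ^ 2 = ∑ i : Fin (n + 1), ((i : ℕ) : ℤ) ^ 2 +
      2 * (n + 1) * ∑ i : Fin (n + 1), ((i : ℕ) : ℤ) * μ i + (n + 1) ^ 2 * ∑ i, (μ i : ℤ) ^ 2 := by
    have : ∑ i, (y i : ℤ) ^ 2 = ∑ i : Fin (n + 1), (((i : ℕ) : ℤ) + (n + 1) * μ i) ^ 2 := by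
      rw [← Equiv.sum_comp σ fun i : Fin (n + 1) => (((i : ℕ) : ℤ) + (n + 1) * μ i) ^ 2]
      exact sum_congr rfl fun i _ => by rw [hy]; push_cast; ring
    rw [this, mul_sum, mul_sum, ← sum_add_distrib, ← sum_add_distrib]
    exact sum_congr rfl fun i _ => by ring
  have hμ' : ∑ i, (μ i : ℤ) = M := by exact_mod_cast hμ
  have hμ2 : 2 * ∑ i, ((μ i).choose 2 : ℤ) = ∑ i, (μ i : ℤ) ^ 2 - M := by
    rw [← hμ', mul_sum, ← sum_sub_distrib]
    exact sum_congr rfl fun i _ => two_mul_choose_two_cast _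
  have hμ3 : ∑ i : Fin (n + 1), ((r : ℤ) + (i : ℕ)) * μ i =
      r * M + ∑ i : Fin (n + 1), ((i : ℕ) : ℤ) * μ i := by
    rw [← hμ', mul_sum, ← sum_add_distrib]
    exact sum_congr rfl fun i _ => by ring
  have hs1 : 2 * ∑ i : Fin (n + 1), ((i : ℕ) : ℤ) = (n + 1) * n := by
    rw [Fin.sum_univ_eq_sum_range (fun i => (i : ℤ)), two_mul_sum_range_cast]
    push_cast; ring
  have hs2 : 6 * ∑ i : Fin (n + 1), ((i : ℕ) : ℤ) ^ 2 = (n + 1) * n * (2 * n + 1) := by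
    rw [Fin.sum_univ_eq_sum_range (fun i => (i : ℤ) ^ 2), six_mul_sum_range_sq_cast]
    push_cast; ring
  have hW : 2 * ∑ a ∈ range n, ((r * a + (a + 1).choose 2 + (r + a).choose 2 : ℕ) : ℤ) =
      2 * ∑ a ∈ range n, (a : ℤ) ^ 2 + 4 * r * ∑ a ∈ range n, (a : ℤ) + n * (r ^ 2 - r) := by
    have h0 : (n : ℤ) * (r ^ 2 - r) = ∑ a ∈ range n, ((r : ℤ) ^ 2 - r) := by
      rw [sum_const, card_range, nsmul_eq_mul]
    rw [h0, mul_sum, mul_sum, mul_sum, ← sum_add_distrib, ← sum_add_distrib]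
    refine sum_congr rfl fun a _ => ?_
    have h1 := two_mul_choose_two_cast (a + 1)
    have h2 := two_mul_choose_two_cast (r + a)
    push_cast at h1 h2 ⊢
    linear_combination h1 + h2
  have hL : 2 * ((n : ℤ) + 1) * ((((n + 1 + 1).choose 2 : ℕ) : ℤ) * (∑ i, k i ^ 2) +
        ∑ i : Fin (n + 1), (((i : ℕ) : ℤ) + 1) * k i -
        ∑ i : Fin (n + 1), ((i : ℕ) : ℤ) * (r + y i) -
        ∑ i, ((r * y i + (y i + 1).choose 2 + r.choose 2 : ℕ) : ℤ)) =
      ∑ i, (y i : ℤ) ^ 2 -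
        (2 * ((n + 2) * (M + n) + 1) + (n + 1) * (2 * r + 1)) * ∑ i, (y i : ℤ) +
        n * ∑ i : Fin (n + 1), ((i : ℕ) : ℤ) ^ 2 +
        (-2 * (n + 2) * (M + n) + 2 * (M + n) - 2 - 2 * (n + 1) * r) *
          ∑ i : Fin (n + 1), ((i : ℕ) : ℤ) +
        (n + 1) * ((n + 2) * (M + n) ^ 2 + 2 * (M + n) - (n + 1) * (r ^ 2 - r)) := by
    have h0 (x : ℤ) : ((n : ℤ) + 1) * x = ∑ i : Fin (n + 1), x := by simp
    rw [h0 ((n + 2) * (M + n) ^ 2 + 2 * (M + n) - (n + 1) * (r ^ 2 - r))]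
    simp only [mul_sum, ← sum_add_distrib, ← sum_sub_distrib]
    refine sum_congr rfl fun i _ => ?_
    have h1 := two_mul_choose_two_cast (n + 1 + 1)
    have h2 := two_mul_choose_two_cast (y i + 1)
    have h3 := two_mul_choose_two_cast r
    have h4 := hk i
    have h5 : (y i : ℤ) = M + n - (i : ℕ) - (n + 1) * k i := by linarith
    push_cast at h1 h2 ⊢
    rw [h5] at h2 ⊢
    linear_combination (n + 1) * k i ^ 2 * h1 - (n + 1) * h2 - (n + 1) * h3
  have ht1 := two_mul_sum_range_cast n
  have ht2 := six_mul_sum_range_sq_cast n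
  have c1 := two_mul_choose_two_cast M
  have c2 := two_mul_choose_two_cast (M + 1)
  have c3 := two_mul_choose_two_cast (r + n)
  have c4 := two_mul_choose_two_cast (n + 1)
  rw [hy2, hy1] at hL
  rw [hμ3]
  have hN : (12 * ((n : ℤ) + 1)) ≠ 0 := by positivity
  refine mul_left_cancel₀ hN ?_
  push_cast at hL hW c1 c2 c3 c4 ⊢
  linear_combination 6 * hL + 6 * ((n : ℤ) + 1) ^ 2 * c1 - 6 * ((n : ℤ) + 1) ^ 2 * hμ2 +
    6 * ((n : ℤ) + 1) * c2 + 6 * ((n : ℤ) + 1) * c3 + 6 * ((n : ℤ) + 1) * c4 +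
    6 * ((n : ℤ) + 1) * hW - 3 * (2 * ((n + 2) * (M + n) + 1) + (n + 1) * (2 * r + 1)) * c4 +
    (n + 1) * hs2 + 3 * (-2 * (n + 2) * (M + n) + 2 * (M + n) - 2 - 2 * (n + 1) * r) * hs1 +
    2 * (n + 1) * ht2 + 12 * (n + 1) * r * ht1

theorem qPoch_zero {F : Type*} [Field F] (q a : F) : qPoch q a 0 = 1 := by
  simp [qPoch]

theorem qPoch_succ {F : Type*} [Field F] (q a : F) (k : ℕ) :
    qPoch q a (k + 1) = qPoch q a k * (1 - a * q ^ k) :=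
  prod_range_succ _ _

theorem qPoch_succ' {F : Type*} [Field F] (q a : F) (k : ℕ) :
    qPoch q a (k + 1) = (1 - a) * qPoch q (a * q) k := by
  rw [qPoch, prod_range_succ', mul_comm]
  simp [qPoch, pow_succ', mul_assoc]

theorem qPoch_add {F : Type*} [Field F] (q a : F) (k l : ℕ) :
    qPoch q a (k + l) = qPoch q a k * qPoch q (a * q ^ k) l := by
  simp [qPoch, prod_range_add, pow_add, mul_assoc]

theorem qPoch_self_ne_zero {F : Type*} [Field F] (q : F) (hq : ∀ m : ℕ, 0 < m → q ^ m ≠ 1)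
    (k : ℕ) : qPoch q q k ≠ 0 := by
  refine prod_ne_zero_iff.2 fun j _ => sub_ne_zero.2 ?_
  rw [← pow_succ']
  exact (hq _ j.succ_pos).symm

theorem qPoch_zpow_neg {F : Type*} [Field F] (q : F) (hq0 : q ≠ 0) (s a : ℕ) :
    qPoch q (q ^ (-((s : ℤ) + a))) a * qPoch q q s =
      (-1) ^ a * q ^ (-((s * a + (a + 1).choose 2 : ℕ) : ℤ)) * qPoch q q (s + a) := by
  induction a with
  | zero => simp [qPoch_zero]
  | succ a ih =>
    have h1 : q ^ (-((s : ℤ) + (a + 1 : ℕ))) * q = q ^ (-((s : ℤ) + a)) := by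
      rw [← zpow_add_one₀ hq0]; congr 1; push_cast; ring
    have h2 : q ^ (-((s * (a + 1) + (a + 1 + 1).choose 2 : ℕ) : ℤ)) =
        q ^ (-((s * a + (a + 1).choose 2 : ℕ) : ℤ)) * q ^ (-((s : ℤ) + (a + 1 : ℕ))) := by
      rw [← zpow_add₀ hq0]
      congr 1
      have e1 := two_mul_choose_two_cast (a + 1)
      have e2 := two_mul_choose_two_cast (a + 1 + 1)
      push_cast at e1 e2 ⊢
      linarith
    have h3 : q ^ (-((s : ℤ) + (a + 1 : ℕ))) * (q * q ^ (s + a)) = 1 := by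
      rw [← pow_succ', ← zpow_natCast, ← zpow_add₀ hq0, ← zpow_zero q]
      congr 1; push_cast; ring
    rw [qPoch_succ', h1, mul_assoc, ih, ← add_assoc, qPoch_succ, h2, pow_succ]
    linear_combination -(-1) ^ a * q ^ (-((s * a + (a + 1).choose 2 : ℕ) : ℤ)) *
      qPoch q q (s + a) * h3

theorem prod_sub_mul_qPoch {F : Type*} [Field F] (q : F) (s y : ℕ) :
    (∏ j ∈ range s, (q ^ (s + y) - q ^ j)) * qPoch q q y =
      (-1) ^ s * q ^ s.choose 2 * qPoch q q (s + y) := by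
  induction s generalizing y with
  | zero => simp
  | succ s ih =>
    have h := ih (y + 1)
    rw [qPoch_succ] at h
    rw [prod_range_succ, add_right_comm, add_assoc s y 1, Nat.choose_succ_succ' s 1,
      Nat.choose_one_right, pow_add q s (s.choose 2), pow_succ (-1 : F)]
    have e : q ^ (s + (y + 1)) - q ^ s = -q ^ s * (1 - q * q ^ y) := by ring
    rw [e]
    linear_combination (-q ^ s) * h

theorem qPoch_zpow_neg_div {F : Type*} [Field F] (q : F) (hq0 : q ≠ 0)
    (hq : ∀ m : ℕ, 0 < m → q ^ m ≠ 1) (s y : ℕ) :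
    qPoch q (q ^ (-((s : ℤ) + y))) y / qPoch q q y =
      (-1) ^ (s + y) * q ^ (-((s * y + (y + 1).choose 2 + s.choose 2 : ℕ) : ℤ)) *
        (∏ j ∈ range s, (q ^ (s + y) - q ^ j)) / qPoch q q s := by
  have h1 := qPoch_zpow_neg q hq0 s y
  have h2 := prod_sub_mul_qPoch q s y
  have n1 := qPoch_self_ne_zero q hq y
  have n2 := qPoch_self_ne_zero q hq s
  rw [div_eq_div_iff n1 n2, h1]
  have h3 : q ^ (-((s * y + (y + 1).choose 2 + s.choose 2 : ℕ) : ℤ)) * q ^ s.choose 2 =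
      q ^ (-((s * y + (y + 1).choose 2 : ℕ) : ℤ)) := by
    rw [← zpow_natCast, ← zpow_add₀ hq0]
    congr 1; push_cast; ring
  have h4 : ((-1 : F) ^ s) * (-1) ^ s = 1 := by rw [← mul_pow]; simp
  rw [mul_assoc _ _ (qPoch q q y), h2, ← h3, pow_add]
  linear_combination -(-1) ^ y * q ^ (-((s * y + (y + 1).choose 2 + s.choose 2 : ℕ) : ℤ)) *
    q ^ s.choose 2 * qPoch q q (s + y) * h4

/-- The `k`-independent part of a summand at the point `q ^ (-r)`. -/
theorem prod_qPoch_zpow_neg {F : Type*} [Field F] (q : F) (hq0 : q ≠ 0)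
    (hq : ∀ m : ℕ, 0 < m → q ^ m ≠ 1) (r n : ℕ) :
    ∏ i : Fin (n + 1), qPoch q (q ^ (-((r : ℤ) + (n - (i : ℕ) : ℕ)))) (n - i) =
      (∏ a ∈ range n, ∏ j ∈ range (r + a), (q ^ (r + a) - q ^ j)) * qPoch q q (r + n) *
        ((-1) ^ (r * n + n) * q ^ (-(((r * n + (n + 1).choose 2 : ℕ) : ℤ) +
          ∑ a ∈ range n, ((r * a + (a + 1).choose 2 + (r + a).choose 2 : ℕ) : ℤ)))) /
        qPoch q q r ^ (n + 1) := by
  have n2 := qPoch_self_ne_zero q hq r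
  have h1 : ∏ i : Fin (n + 1), qPoch q (q ^ (-((r : ℤ) + (n - (i : ℕ) : ℕ)))) (n - i) =
      ∏ a ∈ range (n + 1), qPoch q (q ^ (-((r : ℤ) + a))) a := by
    rw [← Fin.prod_univ_eq_prod_range (fun a => qPoch q (q ^ (-((r : ℤ) + a))) a),
      ← Equiv.prod_comp Fin.revPerm]
    refine prod_congr rfl fun i _ => ?_
    have : n - ((Fin.revPerm i : Fin (n + 1)) : ℕ) = i := by
      rw [Fin.revPerm_apply, Fin.val_rev]
      omega
    rw [this]
  have h2 (n : ℕ) : ∏ a ∈ range n, qPoch q (q ^ (-((r : ℤ) + a))) a =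
      (∏ a ∈ range n, ∏ j ∈ range (r + a), (q ^ (r + a) - q ^ j)) *
        ((-1) ^ (r * n) * q ^ (-
          ∑ a ∈ range n, ((r * a + (a + 1).choose 2 + (r + a).choose 2 : ℕ) : ℤ))) /
        qPoch q q r ^ n := by
    induction n with
    | zero => simp
    | succ n ih =>
      have e1 := qPoch_zpow_neg q hq0 r n
      have e2 := prod_sub_mul_qPoch q (r + n) 0
      rw [qPoch_zero, mul_one, add_zero] at e2
      have e3 : q ^ (-((r * n + (n + 1).choose 2 + (r + n).choose 2 : ℕ) : ℤ)) *
          q ^ (r + n).choose 2 = q ^ (-((r * n + (n + 1).choose 2 : ℕ) : ℤ)) := by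
        rw [← zpow_natCast, ← zpow_add₀ hq0]
        congr 1; push_cast; ring
      have e4 : ((-1 : F) ^ n) * (-1) ^ n = 1 := by rw [← mul_pow]; simp
      have e5 : qPoch q (q ^ (-((r : ℤ) + n))) n =
          (∏ j ∈ range (r + n), (q ^ (r + n) - q ^ j)) * ((-1) ^ r *
            q ^ (-((r * n + (n + 1).choose 2 + (r + n).choose 2 : ℕ) : ℤ))) / qPoch q q r := by
        rw [eq_div_iff n2, e1, e2, ← e3, pow_add]
        have e6 : ((-1 : F) ^ r) * (-1) ^ r = 1 := by rw [← mul_pow]; simp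
        linear_combination -(-1) ^ n * q ^ (-((r * n + (n + 1).choose 2 + (r + n).choose 2 : ℕ) : ℤ)) *
          q ^ (r + n).choose 2 * qPoch q q (r + n) * e6
      rw [prod_range_succ, ih, e5, prod_range_succ, sum_range_succ, neg_add, zpow_add₀ hq0,
        Nat.mul_succ, pow_add (-1 : F), pow_succ (qPoch q q r)]
      ring
  rw [h1, prod_range_succ, h2, eq_div_of_mul_eq n2 (qPoch_zpow_neg q hq0 r n), neg_add,
    zpow_add₀ hq0, pow_add (-1 : F) (r * n), pow_succ (qPoch q q r)]
  ring

theorem prod_one_sub_zpow {F : Type*} [Field F] (q : F) (hq0 : q ≠ 0) (n r : ℕ)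
    (y : Fin n → ℕ) :
    ∏ j : Fin n, ∏ i ∈ univ.filter (fun i : Fin n => i < j), (1 - q ^ ((y i : ℤ) - y j)) =
      q ^ (-∑ i : Fin n, ((i : ℕ) : ℤ) * (r + y i)) *
        powVandermonde q (fun i => (r : ℤ) + y i) := by
  have h2 : powVandermonde q (fun i => (r : ℤ) + y i) =
      ∏ j : Fin n, ∏ i ∈ univ.filter (fun i : Fin n => i < j),
        (q ^ ((r : ℤ) + y j) - q ^ ((r : ℤ) + y i)) := by
    rw [powVandermonde, Matrix.det_vandermonde]
    exact prod_comm' (by simp)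
  rw [h2, ← sum_neg_distrib, zpow_sum₀ hq0, ← prod_mul_distrib]
  refine prod_congr rfl fun j _ => ?_
  have h3 : q ^ (-(((j : ℕ) : ℤ) * (r + y j))) =
      ∏ i ∈ univ.filter (fun i : Fin n => i < j), q ^ (-((r : ℤ) + y j)) := by
    rw [prod_const, ← zpow_natCast, ← zpow_mul]
    congr 1
    have : #{i : Fin n | i < j} = (j : ℕ) := by
      rw [← Fin.card_Iio]; congr 1; ext; simp
    rw [this]; ring
  rw [h3, ← prod_mul_distrib]
  refine prod_congr rfl fun i _ => ?_
  rw [mul_sub, ← zpow_add₀ hq0, ← zpow_add₀ hq0, neg_add_cancel, zpow_zero]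
  congr 2; ring

/-- A summand at the point `q ^ (-r)`, up to factors independent of `μ`, as a summand of
`sum_powVandermonde_eval`. -/
theorem summand_eval {F : Type*} [Field F] (q : F) (hq0 : q ≠ 0)
    (hq : ∀ m : ℕ, 0 < m → q ^ m ≠ 1) (n r M : ℕ) (σ : Equiv.Perm (Fin (n + 1)))
    (hsign : (Equiv.Perm.sign σ : ℤ) = (-1) ^ (n * M + (n + 1).choose 2))
    (μ y : Fin (n + 1) → ℕ) (k : Fin (n + 1) → ℤ) (hy : ∀ i, y i = σ i + (n + 1) * μ (σ i))
    (hk : ∀ i : Fin (n + 1), (n + 1) * k i = M + n - (i : ℕ) - y i) (hμ : ∑ i, μ i = M) :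
    q ^ ((((n + 1 + 1).choose 2 : ℕ) : ℤ) * (∑ i, k i ^ 2) +
          ∑ i : Fin (n + 1), (((i : ℕ) : ℤ) + 1) * k i) *
        (∏ j : Fin (n + 1), ∏ i ∈ univ.filter (fun i : Fin (n + 1) => i < j),
          (1 - q ^ ((y i : ℤ) - y j))) *
        ∏ i : Fin (n + 1), qPoch q (q ^ (-((r : ℤ) + y i))) (y i) / qPoch q q (y i) =
      (-1) ^ (M + r + r * n) / qPoch q q r ^ (n + 1) *
        q ^ (-((((n + 1 : ℕ) : ℤ) * (M.choose 2 : ℤ) + (n + 1 : ℕ) * ((r + n) * M)) +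
          (((r + n) * M + (M + 1).choose 2 + (r + n).choose 2 : ℕ) +
            (r * n + (n + 1).choose 2 : ℕ) +
            ∑ a ∈ range n, ((r * a + (a + 1).choose 2 + (r + a).choose 2 : ℕ) : ℤ)))) *
        (q ^ (((n + 1 : ℕ) : ℤ) * (∑ i, ((μ i).choose 2 : ℤ)) +
            ∑ i : Fin (n + 1), ((r : ℤ) + (i : ℕ)) * μ i) *
          (powVandermonde q (fun i => (r : ℤ) + ((i : ℕ) + (n + 1 : ℕ) * (μ i : ℤ))) *
          ∏ i : Fin (n + 1), ∏ j ∈ range r,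
            (q ^ ((r : ℤ) + ((i : ℕ) + (n + 1 : ℕ) * (μ i : ℤ))) - q ^ j))) := by
  have h1 : powVandermonde q (fun i => (r : ℤ) + y i) =
      (-1) ^ (n * M + (n + 1).choose 2) *
        powVandermonde q (fun i => (r : ℤ) + ((i : ℕ) + (n + 1 : ℕ) * (μ i : ℤ))) := by
    have := powVandermonde_comp_perm q
      (fun i : Fin (n + 1) => (r : ℤ) + ((i : ℕ) + (n + 1 : ℕ) * (μ i : ℤ))) σ
    rw [hsign] at this
    push_cast at this ⊢
    rw [← this]
    congr 1
    funext i
    simp [hy]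
  have h2 : ∏ i : Fin (n + 1), ∏ j ∈ range r, (q ^ (r + y i) - q ^ j) =
      ∏ i : Fin (n + 1), ∏ j ∈ range r,
            (q ^ ((r : ℤ) + ((i : ℕ) + (n + 1 : ℕ) * (μ i : ℤ))) - q ^ j) := by
    rw [← Equiv.prod_comp σ fun i : Fin (n + 1) => ∏ j ∈ range r,
            (q ^ ((r : ℤ) + ((i : ℕ) + (n + 1 : ℕ) * (μ i : ℤ))) - q ^ j)]
    refine prod_congr rfl fun i _ => prod_congr rfl fun j _ => ?_
    rw [hy, ← zpow_natCast q (r + _)]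
    push_cast
    rfl
  have h3 := exponent_identity n r M σ μ y k hy hk hμ
  have h4 : (-1 : F) ^ (∑ i, (r + y i)) * (-1) ^ (n * M + (n + 1).choose 2) =
      (-1) ^ (M + r + r * n) := by
    rw [sum_add_distrib, sum_of_perm hy hμ, ← pow_add]
    have : ∑ i : Fin (n + 1), r + ((n + 1) * M + (n + 1).choose 2) +
        (n * M + (n + 1).choose 2) = M + r + r * n + 2 * (n * M + (n + 1).choose 2) := by
      simp; ring
    rw [this, pow_add _ (M + r + r * n), pow_mul]; simp
  rw [prod_one_sub_zpow q hq0 (n + 1) r y, h1]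
  simp only [qPoch_zpow_neg_div q hq0 hq, prod_div_distrib, prod_mul_distrib, prod_const,
    card_univ, Fintype.card_fin, h2, prod_pow_eq_pow_sum, ← zpow_sum₀ hq0, sum_neg_distrib]
  rw [← h4]
  set A := (((n + 1 + 1).choose 2 : ℕ) : ℤ) * (∑ i, k i ^ 2) +
          ∑ i : Fin (n + 1), (((i : ℕ) : ℤ) + 1) * k i
  set B := ∑ i : Fin (n + 1), ((i : ℕ) : ℤ) * (r + y i)
  set C := ∑ i, ((r * y i + (y i + 1).choose 2 + r.choose 2 : ℕ) : ℤ)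
  have h5 : q ^ A * q ^ (-B) * q ^ (-C) =
      q ^ (-((((n + 1 : ℕ) : ℤ) * (M.choose 2 : ℤ) + (n + 1 : ℕ) * ((r + n) * M)) +
          (((r + n) * M + (M + 1).choose 2 + (r + n).choose 2 : ℕ) +
            (r * n + (n + 1).choose 2 : ℕ) +
            ∑ a ∈ range n, ((r * a + (a + 1).choose 2 + (r + a).choose 2 : ℕ) : ℤ)))) *
        q ^ (((n + 1 : ℕ) : ℤ) * (∑ i, ((μ i).choose 2 : ℤ)) +
            ∑ i : Fin (n + 1), ((r : ℤ) + (i : ℕ)) * μ i) := by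
    rw [← zpow_add₀ hq0, ← zpow_add₀ hq0, ← zpow_add₀ hq0]
    congr 1
    linarith
  linear_combination (-1) ^ (∑ i, (r + y i)) * (-1) ^ (n * M + (n + 1).choose 2) /
    qPoch q q r ^ (n + 1) *
    (powVandermonde q (fun i => (r : ℤ) + ((i : ℕ) + (n + 1 : ℕ) * (μ i : ℤ))) *
          ∏ i : Fin (n + 1), ∏ j ∈ range r,
            (q ^ ((r : ℤ) + ((i : ℕ) + (n + 1 : ℕ) * (μ i : ℤ))) - q ^ j)) * h5

/-- The summation formula at the points `Z = q ^ (-(r + n + 1 + M))`. -/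
theorem sum_eval_at_zpow_neg {F : Type*} [Field F] (q : F) (hq0 : q ≠ 0)
    (hq : ∀ m : ℕ, 0 < m → q ^ m ≠ 1) (n r M : ℕ) (σ : Equiv.Perm (Fin (n + 1)))
    (hsign : (Equiv.Perm.sign σ : ℤ) = (-1) ^ (n * M + (n + 1).choose 2))
    (S : Finset (Fin (n + 1) → ℕ)) (hS : S = piAntidiag univ M)
    (y : (Fin (n + 1) → ℕ) → Fin (n + 1) → ℕ) (k : (Fin (n + 1) → ℕ) → Fin (n + 1) → ℤ)
    (hy : ∀ μ i, y μ i = σ i + (n + 1) * μ (σ i))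
    (hk : ∀ μ ∈ S, ∀ i : Fin (n + 1), (n + 1) * k μ i = M + n - (i : ℕ) - y μ i)
    (Z : F) (hZ : Z = q ^ (-((r : ℤ) + n + 1 + M))) :
    ∑ μ ∈ S, q ^ ((((n + 1 + 1).choose 2 : ℕ) : ℤ) * (∑ i, k μ i ^ 2) +
          ∑ i : Fin (n + 1), (((i : ℕ) : ℤ) + 1) * k μ i) *
        (∏ j : Fin (n + 1), ∏ i ∈ univ.filter (fun i : Fin (n + 1) => i < j),
          (1 - q ^ ((y μ i : ℤ) - y μ j))) *
        ∏ i : Fin (n + 1), qPoch q (Z * q ^ ((M : ℤ) + n + 1 - y μ i)) (y μ i + (i + 1)) /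
          qPoch q q (y μ i) =
      qPoch q (Z * q) M / qPoch q q M *
        ∏ i : Fin (n + 1), qPoch q (Z * q ^ (M + (i : ℕ) + 1)) (n + 1) := by
  have n2 := qPoch_self_ne_zero q hq r
  have n3 := qPoch_self_ne_zero q hq (r + n)
  have hq' (a b : ℕ) (hab : a < b) : q ^ b ≠ q ^ a := by
    obtain ⟨c, rfl⟩ := Nat.exists_eq_add_of_lt hab
    rw [add_assoc, pow_add]
    intro h
    exact hq (c + 1) c.succ_pos (mul_left_cancel₀ (pow_ne_zero a hq0) (by rw [h, mul_one]))
  have hl (μ : Fin (n + 1) → ℕ) (i : Fin (n + 1)) :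
      qPoch q (Z * q ^ ((M : ℤ) + n + 1 - y μ i)) (y μ i + (i + 1)) =
        qPoch q (q ^ (-((r : ℤ) + y μ i))) (y μ i) * qPoch q (q ^ (-(r : ℤ))) (i + 1) := by
    rw [qPoch_add, hZ, ← zpow_add₀ hq0, ← zpow_natCast q (y μ i), ← zpow_add₀ hq0]
    congr 3 <;> ring
  have hr (i : Fin (n + 1)) : qPoch q (Z * q ^ (M + (i : ℕ) + 1)) (n + 1) =
      qPoch q (q ^ (-((r : ℤ) + (n - (i : ℕ) : ℕ)))) (n - i) *
        qPoch q (q ^ (-(r : ℤ))) (i + 1) := by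
    have hi : (i : ℕ) ≤ n := by omega
    have : qPoch q (Z * q ^ (M + (i : ℕ) + 1)) (n + 1) =
      qPoch q (Z * q ^ (M + (i : ℕ) + 1)) ((n - i) + (i + 1)) := by congr 1; omega
    rw [this, qPoch_add, hZ, ← zpow_natCast q (n - i), ← zpow_natCast q (M + i + 1),
      ← zpow_add₀ hq0, ← zpow_add₀ hq0]
    push_cast [hi]
    congr 3 <;> ring
  have hM : Z * q = q ^ (-(((r + n : ℕ) : ℤ) + M)) := by
    rw [hZ, ← zpow_add_one₀ hq0]
    congr 1; push_cast; ring
  simp only [hl, hr, mul_div_right_comm, prod_mul_distrib, ← mul_assoc, ← sum_mul]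
  congr 1
  have hmain := sum_powVandermonde_eval q hq0 hq' r n M
  rw [sum_congr rfl fun μ hμ => summand_eval q hq0 hq n r M σ hsign μ (y μ) (k μ) (hy μ) (hk μ hμ)
    (by simpa [hS] using hμ), ← mul_sum, hS, hmain, hM, qPoch_zpow_neg_div q hq0 hq,
    prod_qPoch_zpow_neg q hq0 hq]
  set A := ((n + 1 : ℕ) : ℤ) * (M.choose 2 : ℤ) + (n + 1 : ℕ) * ((r + n) * M)
  set B := ∑ a ∈ range n, ((r * a + (a + 1).choose 2 + (r + a).choose 2 : ℕ) : ℤ)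
  have h1 : q ^ (-(A + ((((r + n) * M + (M + 1).choose 2 + (r + n).choose 2 : ℕ) : ℤ) +
      (r * n + (n + 1).choose 2 : ℕ) + B))) * q ^ A =
      q ^ (-(((r + n) * M + (M + 1).choose 2 + (r + n).choose 2 : ℕ) : ℤ)) *
        q ^ (-(((r * n + (n + 1).choose 2 : ℕ) : ℤ) + B)) := by
    rw [← zpow_add₀ hq0, ← zpow_add₀ hq0]
    congr 1; ring
  have h2 : (-1 : F) ^ (r + n + M) * (-1) ^ (r * n + n) = (-1) ^ (M + r + r * n) := by
    rw [← pow_add, show r + n + M + (r * n + n) = M + r + r * n + 2 * n by ring, pow_add _ _ (2 * n),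
      pow_mul]
    simp
  rw [← h2]
  field_simp
  linear_combination
    ((∏ a ∈ range n, ∏ j ∈ range (r + a), (q ^ (r + a) - q ^ j)) *
          ∏ j ∈ range (r + n), (q ^ (r + n + M) - q ^ j)) * h1

theorem exists_polynomial_eval_eq_qPoch {F : Type*} [Field F] (q c : F) (k : ℕ) :
    ∃ p : Polynomial F, ∀ Z, p.eval Z = qPoch q (Z * c) k := by
  refine ⟨∏ j ∈ range k, (1 - Polynomial.X * Polynomial.C (c * q ^ j)), fun Z => ?_⟩
  simp [Polynomial.eval_prod, qPoch, mul_assoc]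

/-- The summation formula with `q ^ M₁` replaced by an indeterminate, indexed by compositions. -/
theorem sum_eval {F : Type*} [Field F] (q : F) (hq0 : q ≠ 0)
    (hq : ∀ m : ℕ, 0 < m → q ^ m ≠ 1) (n M : ℕ) (σ : Equiv.Perm (Fin (n + 1)))
    (hsign : (Equiv.Perm.sign σ : ℤ) = (-1) ^ (n * M + (n + 1).choose 2))
    (S : Finset (Fin (n + 1) → ℕ)) (hS : S = piAntidiag univ M)
    (y : (Fin (n + 1) → ℕ) → Fin (n + 1) → ℕ) (k : (Fin (n + 1) → ℕ) → Fin (n + 1) → ℤ)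
    (hy : ∀ μ i, y μ i = σ i + (n + 1) * μ (σ i))
    (hk : ∀ μ ∈ S, ∀ i : Fin (n + 1), (n + 1) * k μ i = M + n - (i : ℕ) - y μ i) (Z : F) :
    ∑ μ ∈ S, q ^ ((((n + 1 + 1).choose 2 : ℕ) : ℤ) * (∑ i, k μ i ^ 2) +
          ∑ i : Fin (n + 1), (((i : ℕ) : ℤ) + 1) * k μ i) *
        (∏ j : Fin (n + 1), ∏ i ∈ univ.filter (fun i : Fin (n + 1) => i < j),
          (1 - q ^ ((y μ i : ℤ) - y μ j))) *
        ∏ i : Fin (n + 1), qPoch q (Z * q ^ ((M : ℤ) + n + 1 - y μ i)) (y μ i + (i + 1)) /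
          qPoch q q (y μ i) =
      qPoch q (Z * q) M / qPoch q q M *
        ∏ i : Fin (n + 1), qPoch q (Z * q ^ (M + (i : ℕ) + 1)) (n + 1) := by
  choose P hP using exists_polynomial_eval_eq_qPoch q
  have hl (Z : F) := (Polynomial.eval_finsetSum S (fun μ =>
    Polynomial.C (q ^ ((((n + 1 + 1).choose 2 : ℕ) : ℤ) * (∑ i, k μ i ^ 2) +
          ∑ i : Fin (n + 1), (((i : ℕ) : ℤ) + 1) * k μ i) *
        (∏ j : Fin (n + 1), ∏ i ∈ univ.filter (fun i : Fin (n + 1) => i < j),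
          (1 - q ^ ((y μ i : ℤ) - y μ j)))) *
      ∏ i : Fin (n + 1), (P (q ^ ((M : ℤ) + n + 1 - y μ i)) (y μ i + (i + 1)) *
        Polynomial.C (qPoch q q (y μ i))⁻¹)) Z)
  have hr (Z : F) : (P q M * Polynomial.C (qPoch q q M)⁻¹ *
      ∏ i : Fin (n + 1), P (q ^ (M + (i : ℕ) + 1)) (n + 1)).eval Z =
      qPoch q (Z * q) M / qPoch q q M *
        ∏ i : Fin (n + 1), qPoch q (Z * q ^ (M + (i : ℕ) + 1)) (n + 1) := by
    simp only [Polynomial.eval_mul, Polynomial.eval_prod, Polynomial.eval_C, hP, ← div_eq_mul_inv]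
  simp only [Polynomial.eval_mul, Polynomial.eval_prod, Polynomial.eval_C, hP,
    ← div_eq_mul_inv] at hl
  rw [← hl, ← hr]
  congr 1
  refine Polynomial.eq_of_infinite_eval_eq _ _ (Set.Infinite.mono ?_ (Set.infinite_range_of_injective
    (f := fun r : ℕ => q ^ (-((r : ℤ) + n + 1 + M))) ?_))
  · rintro _ ⟨r, rfl⟩
    simp only [Set.mem_ofPred_eq]
    rw [hl, hr]
    exact sum_eval_at_zpow_neg q hq0 hq n r M σ hsign S hS y k hy hk _ rfl
  · have key (a b : ℕ) (hab : a < b) : q ^ (-((a : ℤ) + n + 1 + M)) ≠ q ^ (-((b : ℤ) + n + 1 + M)) := by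
      intro h
      refine hq (b - a) (by omega) ?_
      rw [← zpow_natCast, Nat.cast_sub hab.le, show (b : ℤ) - a = -((a : ℤ) + n + 1 + M) -
        (-((b : ℤ) + n + 1 + M)) by ring, zpow_sub₀ hq0, h, div_self (zpow_ne_zero _ hq0)]
    intro a b hab
    rcases lt_trichotomy a b with h | h | h
    · exact (key a b h hab).elim
    · exact h
    · exact (key b a h hab.symm).elim

/-- The polynomial form (in `q^{M_1}`) of the `S = 0` case of Warnaar's summation formula. -/
theorem warnaar_sum_polynomial_form {F : Type*} [Field F] (q : F) (hq0 : q ≠ 0)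
    (hq : ∀ m : ℕ, 0 < m → q ^ m ≠ 1)
    (n : ℕ) (hn : 0 < n) (M1 M2 : ℕ) :
    (∑ᶠ k : Fin n → ℤ,
      if (∑ i, k i) = 0 ∧
          ∀ i : Fin n, 0 ≤ (M2 : ℤ) - n * k i + n - ((i : ℕ) + 1) then
        q ^ ((((n + 1).choose 2 : ℕ) : ℤ) * (∑ i, (k i) ^ 2) +
              ∑ i : Fin n, (((i : ℕ) : ℤ) + 1) * k i) *
          (∏ j : Fin n, ∏ i ∈ Finset.univ.filter (fun i : Fin n => i < j),
            (1 - q ^ ((n : ℤ) * k j - (n : ℤ) * k i + ((j : ℕ) : ℤ) - ((i : ℕ) : ℤ)))) *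
          ∏ i : Fin n,
            qPoch q (q ^ ((M1 : ℤ) + n * k i + ((i : ℕ) + 1)))
                (((M2 : ℤ) - n * k i + n).toNat) /
              qPoch q q ((M2 : ℤ) - n * k i + n - ((i : ℕ) + 1)).toNat
      else 0) =
    qPoch q (q ^ (M1 + 1)) M2 / qPoch q q M2 *
      ∏ i : Fin n, qPoch q (q ^ (M1 + M2 + (i : ℕ) + 1)) n := by
  obtain ⟨n, rfl⟩ : ∃ m, n = m + 1 := ⟨n - 1, by omega⟩
  obtain ⟨σ, hsign, hσ⟩ := exists_perm_mod n M2
  set d : Fin (n + 1) → ℕ := fun i => (M2 + (n - i)) / (n + 1) with hd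
  have hdσ (i : Fin (n + 1)) : ((n : ℤ) + 1) * d i + (σ i : ℕ) = M2 + n - (i : ℕ) := by
    have h1 := Nat.div_add_mod (M2 + (n - i)) (n + 1)
    rw [← hσ] at h1
    have hi : (i : ℕ) ≤ n := by omega
    zify [hi] at h1
    simp only [hd]
    push_cast [hi]
    linarith
  have hdsum : ∑ i, (d i : ℤ) = M2 := by exact_mod_cast sum_div_of_perm_mod hσ
  set φ : (Fin (n + 1) → ℕ) → Fin (n + 1) → ℤ := fun μ i => d i - μ (σ i) with hφ
  set y : (Fin (n + 1) → ℕ) → Fin (n + 1) → ℕ := fun μ i => σ i + (n + 1) * μ (σ i) with hy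
  have hφy (μ : Fin (n + 1) → ℕ) (i : Fin (n + 1)) :
      ((n : ℤ) + 1) * φ μ i = M2 + n - (i : ℕ) - y μ i := by
    simp only [hφ, hy]
    push_cast
    linarith [hdσ i]
  have hφinj : Function.Injective φ := by
    intro μ ν h
    funext i
    have := congrFun h (σ.symm i)
    simpa [hφ] using this
  rw [finsum_eq_sum_of_support_subset (s := (piAntidiag univ M2).image φ), sum_image hφinj.injOn]
  · have hmain := sum_eval q hq0 hq n M2 σ hsign _ rfl y φ (fun _ _ => rfl)
      (fun μ _ i => hφy μ i) (q ^ M1)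
    have hr (i : Fin (n + 1)) : q ^ M1 * q ^ (M2 + (i : ℕ) + 1) = q ^ (M1 + M2 + (i : ℕ) + 1) := by
      rw [← pow_add]; congr 1; ring
    simp only [hr, ← pow_succ] at hmain
    rw [← hmain]
    refine sum_congr rfl fun μ hμ => ?_
    simp only [mem_piAntidiag, mem_univ, implies_true, and_true] at hμ
    have e1 (i : Fin (n + 1)) : (M2 : ℤ) - ((n + 1 : ℕ) : ℤ) * φ μ i + ((n + 1 : ℕ) : ℤ) -
        ((i : ℕ) + 1) = (y μ i : ℕ) := by
      push_cast; linarith [hφy μ i]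
    have e2 (i : Fin (n + 1)) : (M2 : ℤ) - ((n + 1 : ℕ) : ℤ) * φ μ i + ((n + 1 : ℕ) : ℤ) =
        (y μ i + (i + 1) : ℕ) := by
      push_cast; linarith [hφy μ i]
    have e3 (i : Fin (n + 1)) : q ^ ((M1 : ℤ) + ((n + 1 : ℕ) : ℤ) * φ μ i + ((i : ℕ) + 1)) =
        q ^ M1 * q ^ ((M2 : ℤ) + n + 1 - y μ i) := by
      rw [← zpow_natCast, ← zpow_add₀ hq0]
      congr 1
      push_cast; linarith [hφy μ i]
    have e4 (i j : Fin (n + 1)) : ((n + 1 : ℕ) : ℤ) * φ μ j - ((n + 1 : ℕ) : ℤ) * φ μ i +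
        ((j : ℕ) : ℤ) - ((i : ℕ) : ℤ) = (y μ i : ℤ) - y μ j := by
      push_cast; linarith [hφy μ i, hφy μ j]
    have e5 : ∑ i, φ μ i = 0 := by
      simp only [hφ, sum_sub_distrib, hdsum]
      rw [Equiv.sum_comp σ fun i => (μ i : ℤ), ← hμ]
      simp
    rw [if_pos ⟨e5, fun i => by rw [e1]; positivity⟩]
    simp only [e1]
    simp only [e2, e3, e4, Int.toNat_natCast]
  · intro k hk
    rw [Function.mem_support] at hk
    have hcond := (ite_ne_right_iff.1 hk).1
    have hpos (i : Fin (n + 1)) : 0 ≤ (d i : ℤ) - k i := by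
      have h1 := hcond.2 i
      have h2 := hdσ i
      have h3 : ((σ i : ℕ) : ℤ) < n + 1 := by exact_mod_cast (σ i).isLt
      push_cast at h1
      by_contra hneg
      have : (d i : ℤ) - k i ≤ -1 := by omega
      nlinarith
    simp only [coe_image, Set.mem_image, mem_coe, mem_piAntidiag, mem_univ, implies_true, and_true]
    refine ⟨fun j => ((d (σ.symm j) : ℤ) - k (σ.symm j)).toNat, ?_, ?_⟩
    · zify
      rw [← Equiv.sum_comp σ]
      simp only [Equiv.symm_apply_apply, Int.toNat_of_nonneg (hpos _), sum_sub_distrib, hdsum,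
        hcond.1, sub_zero]
    · funext i
      simp only [hφ, Equiv.symm_apply_apply, Int.toNat_of_nonneg (hpos _)]
      ring
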